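/- Let X be a Banach space, E a reflexive Banach space, T : E → X a compact linear operator, and K a nonempty compact subset of X with K ⊆ T(B_E), where B_E is the closed unit ball of E. Then for every greedy sequence for K and every n ≥ 1, (∏_{k=0}^{3n−1} σ_k(K)_X)^{1/(3n)} ≤ 3e²·Γ_n(E)·Γ_n(X)·(∏_{k=0}^{n−1} d^k(T))^{1/n}, where d^k(T) denotes the k-th Gelfand width of T. -/

import Mathlib

open scoped BigOperators NNReal ENNReal

noncomputable section

/-- The span of the first `n` elements of the sequence `f`. -/
def greedySpan {X : Type*} [NormedAddCommGroup X] [NormedSpace ℝ X]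
    (f : ℕ → X) (n : ℕ) : Submodule ℝ X :=
  Submodule.span ℝ (f '' Set.Iio n)

/-- The `n`-th greedy error `σ_n = dist(f_n, V_n)`. For `n = 0` this is `‖f 0‖`. -/
def greedyErr {X : Type*} [NormedAddCommGroup X] [NormedSpace ℝ X]
    (f : ℕ → X) (n : ℕ) : ℝ :=
  Metric.infDist (f n) (greedySpan f n : Set X)

/-- `f` is a greedy sequence for `K`: each `f n` lies in `K` and maximizes the distance to
`V_n = span{f_0,…,f_{n-1}}` among elements of `K` (for `n = 0`, `‖f 0‖ = max_{g∈K} ‖g‖`). -/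
def IsGreedySeq {X : Type*} [NormedAddCommGroup X] [NormedSpace ℝ X]
    (K : Set X) (f : ℕ → X) : Prop :=
  ∀ n : ℕ, f n ∈ K ∧ ∀ g ∈ K, Metric.infDist g (greedySpan f n : Set X) ≤ greedyErr f n

/-- Kolmogorov `n`-width of a set `K ⊆ X`. -/
def kolWidth {X : Type*} [NormedAddCommGroup X] [NormedSpace ℝ X]
    (K : Set X) : ℕ → ℝ
  | 0 => ⨆ g ∈ K, ‖g‖
  | (n+1) => ⨅ L : {L : Submodule ℝ X // Module.finrank ℝ L = n + 1},
      ⨆ g ∈ K, Metric.infDist g (L.1 : Set X)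

/-- Kolmogorov `n`-width of a bounded linear operator `T : E → X`. -/
def kolWidthOp {E X : Type*} [NormedAddCommGroup E] [NormedSpace ℝ E]
    [NormedAddCommGroup X] [NormedSpace ℝ X] (T : E →L[ℝ] X) : ℕ → ℝ
  | 0 => ‖T‖
  | (n+1) => ⨅ L : {L : Submodule ℝ X // Module.finrank ℝ L = n + 1},
      ⨆ x : {x : E // ‖x‖ ≤ 1}, Metric.infDist (T x.1) (L.1 : Set X)

/-- Gelfand `n`-width of a bounded linear operator `T : E → X`. -/
def gelfandWidthOp {E X : Type*} [NormedAddCommGroup E] [NormedSpace ℝ E]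
    [NormedAddCommGroup X] [NormedSpace ℝ X] (T : E →L[ℝ] X) : ℕ → ℝ
  | 0 => ‖T‖
  | (n+1) => ⨅ L : {L : Submodule ℝ E // IsClosed (L : Set E) ∧
        FiniteDimensional ℝ (E ⧸ L) ∧ Module.finrank ℝ (E ⧸ L) ≤ n + 1},
      ⨆ x : {x : E // x ∈ L.1 ∧ ‖x‖ ≤ 1}, ‖T x.1‖

/-- The `n`-th Grothendieck number of a bounded linear operator `T : X → Y`. -/
def grothOp {X Y : Type*} [NormedAddCommGroup X] [NormedSpace ℝ X]
    [NormedAddCommGroup Y] [NormedSpace ℝ Y] (T : X →L[ℝ] Y) (n : ℕ) : ℝ :=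
  ⨆ p : (Fin n → {x : X // ‖x‖ ≤ 1}) × (Fin n → {b : Y →L[ℝ] ℝ // ‖b‖ ≤ 1}),
    |Matrix.det (Matrix.of fun i j => (p.2 j).1 (T (p.1 i).1))| ^ ((1 : ℝ) / n)

/-- The `n`-th Grothendieck number of the Banach space `X`. -/
def groth (X : Type*) [NormedAddCommGroup X] [NormedSpace ℝ X] (n : ℕ) : ℝ :=
  grothOp (ContinuousLinearMap.id ℝ X) n

/-- Banach–Mazur distance between two normed spaces. -/
def bmDist (X Y : Type*) [NormedAddCommGroup X] [NormedSpace ℝ X]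
    [NormedAddCommGroup Y] [NormedSpace ℝ Y] : ℝ :=
  ⨅ T : X ≃L[ℝ] Y, ‖(T : X →L[ℝ] Y)‖ * ‖(T.symm : Y →L[ℝ] X)‖

/-- `γ_n(X)`: supremum of Banach–Mazur distances of `n`-dimensional subspaces of `X`
to `n`-dimensional Euclidean space. -/
def gammaBM (X : Type*) [NormedAddCommGroup X] [NormedSpace ℝ X] (n : ℕ) : ℝ :=
  ⨆ V : {V : Submodule ℝ X // Module.finrank ℝ V = n},
    bmDist V.1 (EuclideanSpace ℝ (Fin n))

/-- `T` satisfies the absolutely 2-summing inequality with constant `C`. -/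
def Summing2Bound {X Y : Type*} [NormedAddCommGroup X] [NormedSpace ℝ X]
    [NormedAddCommGroup Y] [NormedSpace ℝ Y] (T : X →L[ℝ] Y) (C : ℝ) : Prop :=
  ∀ (N : ℕ) (x : Fin N → X),
    (∑ i, ‖T (x i)‖ ^ 2) ^ ((1 : ℝ) / 2) ≤
      C * ⨆ b : {b : X →L[ℝ] ℝ // ‖b‖ ≤ 1}, (∑ i, (b.1 (x i)) ^ 2) ^ ((1 : ℝ) / 2)

/-- `T` is absolutely 2-summing. -/
def IsSumming2 {X Y : Type*} [NormedAddCommGroup X] [NormedSpace ℝ X]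
    [NormedAddCommGroup Y] [NormedSpace ℝ Y] (T : X →L[ℝ] Y) : Prop :=
  ∃ C : ℝ, 0 ≤ C ∧ Summing2Bound T C

/-- The 2-summing norm `‖T | B₂‖`. -/
def summing2Norm {X Y : Type*} [NormedAddCommGroup X] [NormedSpace ℝ X]
    [NormedAddCommGroup Y] [NormedSpace ℝ Y] (T : X →L[ℝ] Y) : ℝ :=
  sInf {C : ℝ | 0 ≤ C ∧ Summing2Bound T C}

end
/-- Over a finite-dimensional `F` of dimension at least `m`, subspaces `L k` of codimension at most
`k` admit a biorthogonal-type triangular system `u k ∈ F ⊓ L k`, `a j`. -/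
theorem exists_triangular_system {E : Type*} [NormedAddCommGroup E] [NormedSpace ℝ E]
    (L : ℕ → Submodule ℝ E) (hL : ∀ k, FiniteDimensional ℝ (E ⧸ L k))
    (hLk : ∀ k, Module.finrank ℝ (E ⧸ L k) ≤ k) (m : ℕ) :
    ∀ F : Submodule ℝ E, FiniteDimensional ℝ F → m ≤ Module.finrank ℝ F →
      ∃ (u : ℕ → E) (a : ℕ → (E →L[ℝ] ℝ)), ∀ k < m, u k ∈ F ∧ u k ∈ L k ∧ ‖u k‖ ≤ 1 ∧
        ‖a k‖ ≤ 1 ∧ a k (u k) = 1 ∧ ∀ j < m, k < j → a j (u k) = 0 := by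
  induction m with
  | zero => intro F _ _; exact ⟨0, 0, by simp⟩
  | succ m ih =>
    intro F hF hm
    have := hL m
    have hker : LinearMap.ker ((L m).mkQ.domRestrict F) ≠ ⊥ :=
      LinearMap.ker_ne_bot_of_finrank_lt (lt_of_le_of_lt (hLk m) hm)
    obtain ⟨v, hv, hv0⟩ := Submodule.exists_mem_ne_zero_of_ne_bot hker
    have hvL : (v : E) ∈ L m := by simpa using hv
    have hv0' : (v : E) ≠ 0 := by simpa using hv0
    have hnv : ‖(v : E)‖ ≠ 0 := norm_ne_zero_iff.mpr hv0'
    obtain ⟨g, hg, hgv⟩ := exists_dual_vector'' ℝ (v : E)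
    set w : E := ‖(v : E)‖⁻¹ • (v : E)
    have hgw : g w = 1 := by simp [w, hgv, hnv]
    have hw : ‖w‖ ≤ 1 := by simp [w, norm_smul, hnv]
    let G := LinearMap.ker ((g : E →ₗ[ℝ] ℝ).domRestrict F)
    have hGdim : m ≤ Module.finrank ℝ (G.map F.subtype) := by
      rw [Submodule.finrank_map_subtype_eq]
      have h1 := LinearMap.finrank_range_add_finrank_ker ((g : E →ₗ[ℝ] ℝ).domRestrict F)
      have h2 := Submodule.finrank_le (LinearMap.range ((g : E →ₗ[ℝ] ℝ).domRestrict F))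
      rw [Module.finrank_self] at h2
      change m ≤ Module.finrank ℝ (LinearMap.ker ((g : E →ₗ[ℝ] ℝ).domRestrict F))
      omega
    obtain ⟨u, a, h⟩ := ih (G.map F.subtype) inferInstance hGdim
    have hG : ∀ x ∈ G.map F.subtype, x ∈ F ∧ g x = 0 := by
      rintro x ⟨y, hy, rfl⟩
      exact ⟨y.2, by simpa [G] using hy⟩
    refine ⟨Function.update u m w, Function.update a m g, fun k hk => ?_⟩
    rcases Nat.lt_succ_iff_lt_or_eq.mp hk with hk | rfl
    · obtain ⟨h1, h2, h3, h4, h5, h6⟩ := h k hk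
      simp only [Function.update_of_ne hk.ne]
      refine ⟨(hG _ h1).1, h2, h3, h4, h5, fun j hj hkj => ?_⟩
      rcases Nat.lt_succ_iff_lt_or_eq.mp hj with hj | rfl
      · simpa [Function.update_of_ne hj.ne] using h6 j hj hkj
      · simpa using (hG _ h1).2
    · simp only [Function.update_self]
      exact ⟨F.smul_mem _ v.2, (L k).smul_mem _ hvL, hw, hg, hgw, fun j hj hkj => by omega⟩

/-- A functional of norm at most one that annihilates `V` and attains the distance to `V`. -/
theorem exists_functional_eq_infDist {X : Type*} [NormedAddCommGroup X] [NormedSpace ℝ X]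
    (V : Submodule ℝ X) (x : X) :
    ∃ b : X →L[ℝ] ℝ, ‖b‖ ≤ 1 ∧ (∀ v ∈ V, b v = 0) ∧ b x = Metric.infDist x (V : Set X) := by
  obtain ⟨g, hg, hgx⟩ := exists_dual_vector'' ℝ (V.mkQ x)
  refine ⟨g.comp V.mkQL, ?_, fun v hv => ?_, ?_⟩
  · refine ContinuousLinearMap.opNorm_le_bound _ zero_le_one fun y => ?_
    calc ‖g (V.mkQ y)‖ ≤ ‖g‖ * ‖V.mkQ y‖ := g.le_opNorm _
      _ ≤ 1 * ‖y‖ := by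
        gcongr
        exact Submodule.Quotient.norm_mk_le V y
  · simp [(Submodule.Quotient.mk_eq_zero V).mpr hv]
  · exact hgx.trans (QuotientAddGroup.norm_mk (S := V.toAddSubgroup) x)

theorem groth_nonneg (X : Type*) [NormedAddCommGroup X] [NormedSpace ℝ X] (n : ℕ) :
    0 ≤ groth X n :=
  Real.iSup_nonneg fun _ => by positivity

theorem abs_det_le_groth_pow {X : Type*} [NormedAddCommGroup X] [NormedSpace ℝ X] {n : ℕ}
    (hn : n ≠ 0) (x : Fin n → X) (b : Fin n → (X →L[ℝ] ℝ)) (hx : ∀ i, ‖x i‖ ≤ 1)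
    (hb : ∀ i, ‖b i‖ ≤ 1) :
    |(Matrix.of fun i j => b j (x i)).det| ≤ groth X n ^ n := by
  have hentry : ∀ (x : X) (b : X →L[ℝ] ℝ), ‖x‖ ≤ 1 → ‖b‖ ≤ 1 → |b x| ≤ 1 := fun x b hx hb =>
    (b.le_opNorm x).trans (mul_le_one₀ hb (norm_nonneg _) hx)
  have hbdd : BddAbove (Set.range fun p : (Fin n → {x : X // ‖x‖ ≤ 1}) ×
      (Fin n → {b : X →L[ℝ] ℝ // ‖b‖ ≤ 1}) =>
      |Matrix.det (Matrix.of fun i j => (p.2 j).1 (ContinuousLinearMap.id ℝ X (p.1 i).1))|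
        ^ ((1 : ℝ) / n)) := by
    refine ⟨((Nat.factorial n : ℝ)) ^ ((1 : ℝ) / n), ?_⟩
    rintro _ ⟨p, rfl⟩
    refine Real.rpow_le_rpow (abs_nonneg _) ?_ (by positivity)
    have := Matrix.det_le (A := Matrix.of fun i j =>
      (p.2 j).1 (ContinuousLinearMap.id ℝ X (p.1 i).1)) (abv := AbsoluteValue.abs) (x := (1 : ℝ))
      (fun i j => hentry _ _ (p.1 i).2 (p.2 j).2)
    simpa using this
  have h := le_ciSup hbdd (fun i => ⟨x i, hx i⟩, fun i => ⟨b i, hb i⟩)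
  calc |(Matrix.of fun i j => b j (x i)).det|
      = (|(Matrix.of fun i j => b j (x i)).det| ^ ((1 : ℝ) / n)) ^ n := by
        rw [one_div, Real.rpow_inv_natCast_pow (abs_nonneg _) hn]
    _ ≤ groth X n ^ n := pow_le_pow_left₀ (by positivity) h n

theorem abs_det_le_groth_pow_mul_prod_norm {X : Type*} [NormedAddCommGroup X] [NormedSpace ℝ X]
    {n : ℕ} (hn : n ≠ 0) (x : Fin n → X) (b : Fin n → (X →L[ℝ] ℝ)) (hb : ∀ i, ‖b i‖ ≤ 1) :
    |(Matrix.of fun i j => b j (x i)).det| ≤ groth X n ^ n * ∏ i, ‖x i‖ := by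
  have hsmul : ∀ i, ‖x i‖ • ‖x i‖⁻¹ • x i = x i := fun i => by
    rcases eq_or_ne (x i) 0 with h | h
    · simp [h]
    · rw [smul_inv_smul₀ (norm_ne_zero_iff.mpr h)]
  have hM : (Matrix.of fun i j => b j (x i)) =
      Matrix.of fun i j => ‖x i‖ * (Matrix.of fun i j => b j (‖x i‖⁻¹ • x i)) i j := by
    ext i j
    simp only [Matrix.of_apply]
    rw [← smul_eq_mul, ← map_smul, hsmul]
  have hdet := Matrix.det_mul_column (fun i => ‖x i‖)
    (Matrix.of fun i j => b j (‖x i‖⁻¹ • x i))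
  rw [hM, hdet, abs_mul, abs_of_nonneg (by positivity), mul_comm]
  gcongr
  refine abs_det_le_groth_pow hn _ b (fun i => ?_) hb
  rw [norm_smul, norm_inv, norm_norm]
  exact inv_mul_le_one

theorem gelfandWidthOp_nonneg {E X : Type*} [NormedAddCommGroup E] [NormedSpace ℝ E]
    [NormedAddCommGroup X] [NormedSpace ℝ X] (T : E →L[ℝ] X) (k : ℕ) :
    0 ≤ gelfandWidthOp T k := by
  cases k with
  | zero => exact norm_nonneg T
  | succ k => exact Real.iInf_nonneg fun _ => Real.iSup_nonneg fun _ => norm_nonneg _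

theorem exists_subspace_norm_le_gelfandWidthOp_add {E X : Type*} [NormedAddCommGroup E]
    [NormedSpace ℝ E] [NormedAddCommGroup X] [NormedSpace ℝ X] (T : E →L[ℝ] X) {ε : ℝ}
    (hε : 0 < ε) (k : ℕ) :
    ∃ L : Submodule ℝ E, FiniteDimensional ℝ (E ⧸ L) ∧ Module.finrank ℝ (E ⧸ L) ≤ k ∧
      ∀ x ∈ L, ‖x‖ ≤ 1 → ‖T x‖ ≤ gelfandWidthOp T k + ε := by
  cases k with
  | zero =>
    refine ⟨⊤, inferInstance, Module.finrank_zero_of_subsingleton.le, fun x _ hx => ?_⟩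
    have : ‖T x‖ ≤ ‖T‖ := T.unit_le_opNorm x hx
    simp only [gelfandWidthOp]
    linarith
  | succ k =>
    have : Nonempty {L : Submodule ℝ E // IsClosed (L : Set E) ∧
        FiniteDimensional ℝ (E ⧸ L) ∧ Module.finrank ℝ (E ⧸ L) ≤ k + 1} :=
      ⟨⟨⊤, isClosed_univ, inferInstance,
        Module.finrank_zero_of_subsingleton.le.trans (Nat.zero_le _)⟩⟩
    obtain ⟨L, hL⟩ := exists_lt_of_ciInf_lt
      (show gelfandWidthOp T (k + 1) < gelfandWidthOp T (k + 1) + ε by linarith)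
    refine ⟨L.1, L.2.2.1, L.2.2.2, fun x hx hx1 => le_trans ?_ hL.le⟩
    refine le_ciSup (f := fun x : {x : E // x ∈ L.1 ∧ ‖x‖ ≤ 1} => ‖T x.1‖) ?_ ⟨x, hx, hx1⟩
    refine ⟨‖T‖, ?_⟩
    rintro _ ⟨y, rfl⟩
    exact T.unit_le_opNorm _ y.2.2

/-- Determinants of `T` are controlled by Grothendieck numbers and Gelfand widths. -/
theorem abs_det_le_groth_mul_prod_gelfandWidthOp {E X : Type*} [NormedAddCommGroup E]
    [NormedSpace ℝ E] [NormedAddCommGroup X] [NormedSpace ℝ X] (T : E →L[ℝ] X) {n : ℕ}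
    (hn : n ≠ 0) (x : Fin n → E) (b : Fin n → (X →L[ℝ] ℝ)) (hx : ∀ i, ‖x i‖ ≤ 1)
    (hb : ∀ i, ‖b i‖ ≤ 1) :
    |(Matrix.of fun i j => b j (T (x i))).det| ≤
      groth E n ^ n * groth X n ^ n * ∏ k ∈ Finset.range n, gelfandWidthOp T k := by
  have hE := groth_nonneg E n
  have hX := groth_nonneg X n
  by_cases hdet : (Matrix.of fun i j => b j (T (x i))).det = 0
  · rw [hdet, abs_zero]
    have := Finset.prod_nonneg fun k (_ : k ∈ Finset.range n) => gelfandWidthOp_nonneg T k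
    positivity
  have hli : LinearIndependent ℝ x :=
    LinearIndependent.of_comp
      (LinearMap.pi fun j => ((b j).comp T : E →ₗ[ℝ] ℝ) : E →ₗ[ℝ] (Fin n → ℝ))
      (Matrix.linearIndependent_rows_of_det_ne_zero hdet)
  have hε : ∀ ε : ℝ, 0 < ε → |(Matrix.of fun i j => b j (T (x i))).det| ≤
      groth E n ^ n * groth X n ^ n * ∏ k ∈ Finset.range n, (gelfandWidthOp T k + ε) := by
    intro ε hε
    choose L hLfin hLk hLT using exists_subspace_norm_le_gelfandWidthOp_add T hε
    obtain ⟨u, a, h⟩ := exists_triangular_system L hLfin hLk n (Submodule.span ℝ (Set.range x))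
      (FiniteDimensional.span_of_finite ℝ (Set.finite_range x))
      (by rw [finrank_span_eq_card hli, Fintype.card_fin])
    have hspan : ∀ k : Fin n, ∃ c : Fin n → ℝ, ∑ i, c i • x i = u k := fun k =>
      (Submodule.mem_span_range_iff_exists_fun ℝ).mp (h k k.2).1
    choose C hC using hspan
    have hmul : ∀ (b : Fin n → (E →L[ℝ] ℝ)), (Matrix.of fun k j : Fin n => b j (u k)) =
        Matrix.of C * Matrix.of fun i j => b j (x i) := by
      intro b
      ext k j
      simp [Matrix.mul_apply, ← hC]
    have hA : (Matrix.of C).det * (Matrix.of fun i j : Fin n => a j (x i)).det = 1 := by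
      rw [← Matrix.det_mul, ← hmul fun j => a j, Matrix.det_of_isLowerTriangular]
      · exact Finset.prod_eq_one fun k _ => (h k k.2).2.2.2.2.1
      · intro i j hij
        exact (h i i.2).2.2.2.2.2 j j.2 hij
    have hB : (Matrix.of fun i j : Fin n => b j (T (u i))).det =
        (Matrix.of C).det * (Matrix.of fun i j => b j (T (x i))).det := by
      rw [← Matrix.det_mul]
      exact congrArg Matrix.det (hmul fun j => (b j).comp T)
    have hkey : (Matrix.of fun i j => b j (T (x i))).det =
        (Matrix.of fun i j : Fin n => a j (x i)).det *
          (Matrix.of fun i j : Fin n => b j (T (u i))).det := by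
      rw [hB, ← mul_assoc, mul_comm _ (Matrix.of C).det, hA, one_mul]
    rw [hkey, abs_mul, mul_assoc]
    have h1 := abs_det_le_groth_pow hn x (fun j => a j) hx fun j => (h j j.2).2.2.2.1
    have h2 := abs_det_le_groth_pow_mul_prod_norm hn (fun i : Fin n => T (u i)) b hb
    have h3 : ∏ i : Fin n, ‖T (u i)‖ ≤ ∏ k ∈ Finset.range n, (gelfandWidthOp T k + ε) := by
      rw [Finset.prod_range]
      exact Finset.prod_le_prod (fun _ _ => norm_nonneg _) fun i _ =>
        hLT i (u i) (h i i.2).2.1 (h i i.2).2.2.1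
    gcongr
    exact h2.trans (by gcongr)
  have hcont : Filter.Tendsto (fun ε : ℝ => groth E n ^ n * groth X n ^ n *
      ∏ k ∈ Finset.range n, (gelfandWidthOp T k + ε)) (nhdsWithin 0 (Set.Ioi 0))
      (nhds (groth E n ^ n * groth X n ^ n *
        ∏ k ∈ Finset.range n, (gelfandWidthOp T k + 0))) :=
    (Continuous.tendsto (by fun_prop) 0).mono_left nhdsWithin_le_nhds
  simpa using ge_of_tendsto hcont (Filter.eventually_of_mem self_mem_nhdsWithin hε)

theorem IsGreedySeq.antitone_greedyErr {X : Type*} [NormedAddCommGroup X] [NormedSpace ℝ X]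
    {K : Set X} {f : ℕ → X} (hf : IsGreedySeq K f) : Antitone (greedyErr f) := by
  refine antitone_nat_of_succ_le fun n => ?_
  refine le_trans (Metric.infDist_le_infDist_of_subset ?_ ⟨0, Submodule.zero_mem _⟩)
    ((hf n).2 _ (hf (n + 1)).1)
  exact Submodule.span_mono (Set.image_mono (Set.Iio_subset_Iio n.le_succ))

theorem prod_greedyErr_le {E X : Type*} [NormedAddCommGroup E]
    [NormedSpace ℝ E] [NormedAddCommGroup X] [NormedSpace ℝ X] (T : E →L[ℝ] X) {K : Set X}
    (hKT : K ⊆ T '' Metric.closedBall 0 1) {f : ℕ → X} (hf : IsGreedySeq K f) {n : ℕ}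
    (hn : n ≠ 0) :
    ∏ k ∈ Finset.range n, greedyErr f k ≤
      groth E n ^ n * groth X n ^ n * ∏ k ∈ Finset.range n, gelfandWidthOp T k := by
  choose x hx hTx using fun k => hKT (hf k).1
  choose b hb hbV hbf using fun k => exists_functional_eq_infDist (greedySpan f k) (f k)
  have h := abs_det_le_groth_mul_prod_gelfandWidthOp T hn (fun i : Fin n => x i)
    (fun j => b j) (fun i => by simpa using hx i) (fun j => hb j)
  simp only [hTx] at h
  rw [Matrix.det_of_isLowerTriangular] at h
  · refine le_trans (le_of_eq ?_) ((le_abs_self _).trans h)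
    rw [Finset.prod_range]
    exact Finset.prod_congr rfl fun i _ => (hbf i).symm
  · intro i j hij
    exact hbV j _ (Submodule.subset_span ⟨i, hij, rfl⟩)

/-- Geometric means of an antitone nonnegative sequence decrease along multiples. -/
theorem prod_range_mul_le_prod_range_pow {s : ℕ → ℝ} (hs : Antitone s) (h0 : ∀ k, 0 ≤ s k)
    (m n : ℕ) :
    ∏ k ∈ Finset.range (m * n), s k ≤ (∏ k ∈ Finset.range n, s k) ^ m := by
  induction m with
  | zero => simp
  | succ m ih =>
    rw [Nat.succ_mul, Finset.prod_range_add, pow_succ]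
    refine mul_le_mul ih ?_ (Finset.prod_nonneg fun k _ => h0 _)
      (pow_nonneg (Finset.prod_nonneg fun k _ => h0 _) _)
    exact Finset.prod_le_prod (fun k _ => h0 _) fun k _ => hs (Nat.le_add_left _ _)

theorem greedy_geometric_mean_bound_gelfand
    {X E : Type*} [NormedAddCommGroup X] [NormedSpace ℝ X] [CompleteSpace X]
    [NormedAddCommGroup E] [NormedSpace ℝ E] [CompleteSpace E]
    (hrefl : Function.Surjective (NormedSpace.inclusionInDoubleDual ℝ E))
    (T : E →L[ℝ] X) (hT : IsCompactOperator T)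
    (K : Set X) (hKc : IsCompact K) (hKne : K.Nonempty)
    (hKT : K ⊆ T '' Metric.closedBall 0 1) :
    ∀ f : ℕ → X, IsGreedySeq K f → ∀ n : ℕ, 1 ≤ n →
      (∏ k ∈ Finset.range (3 * n), greedyErr f k) ^ ((1 : ℝ) / (3 * n)) ≤
        3 * Real.exp 1 ^ 2 * groth E n * groth X n *
          (∏ k ∈ Finset.range n, gelfandWidthOp T k) ^ ((1 : ℝ) / n) := by
  intro f hf n hn
  have hn0 : n ≠ 0 := by omega
  have hσ : ∀ k, 0 ≤ greedyErr f k := fun _ => Metric.infDist_nonneg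
  have hE := groth_nonneg E n
  have hX := groth_nonneg X n
  have hP := Finset.prod_nonneg fun k (_ : k ∈ Finset.range n) => hσ k
  have hD := Finset.prod_nonneg fun k (_ : k ∈ Finset.range n) => gelfandWidthOp_nonneg T k
  have hexp : (1 : ℝ) ≤ 3 * Real.exp 1 ^ 2 := by
    have := one_le_pow₀ (n := 2) (Real.one_le_exp zero_le_one)
    linarith
  calc (∏ k ∈ Finset.range (3 * n), greedyErr f k) ^ ((1 : ℝ) / (3 * n))
      ≤ ((∏ k ∈ Finset.range n, greedyErr f k) ^ 3) ^ ((1 : ℝ) / (3 * n)) :=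
        Real.rpow_le_rpow (Finset.prod_nonneg fun k _ => hσ k)
          (prod_range_mul_le_prod_range_pow hf.antitone_greedyErr hσ 3 n) (by positivity)
    _ = (∏ k ∈ Finset.range n, greedyErr f k) ^ ((1 : ℝ) / n) := by
        rw [← Real.rpow_natCast, ← Real.rpow_mul hP]
        congr 1
        field_simp
        norm_num
    _ ≤ (groth E n ^ n * groth X n ^ n * ∏ k ∈ Finset.range n, gelfandWidthOp T k)
          ^ ((1 : ℝ) / n) :=
        Real.rpow_le_rpow hP (prod_greedyErr_le T hKT hf hn0) (by positivity)
    _ = groth E n * groth X n *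
          (∏ k ∈ Finset.range n, gelfandWidthOp T k) ^ ((1 : ℝ) / n) := by
        rw [← mul_pow, Real.mul_rpow (by positivity) hD, one_div,
          Real.pow_rpow_inv_natCast (by positivity) hn0]
    _ ≤ 3 * Real.exp 1 ^ 2 * groth E n * groth X n *
          (∏ k ∈ Finset.range n, gelfandWidthOp T k) ^ ((1 : ℝ) / n) := by
        rw [mul_assoc (3 * Real.exp 1 ^ 2), mul_assoc (3 * Real.exp 1 ^ 2)]
        exact le_mul_of_one_le_left (by positivity) hexp
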